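/- Frame on denotations: let C̄ be a command sequence and a = (ψ, S) a resource such that t = ⟦C̄⟧(a) is defined, and let x be a resource such that the resource product a·x is defined and t' = ⟦C̄⟧(a·x) is also defined. Then t' is obtained from t by replacing every leaf Leaf(b) by Leaf(b·x); in particular t and t' have the same tree shape and b·x is defined for every leaf b of t. -/

import Mathlib

open scoped Classical

noncomputable section

namespace QSL

/-! ## Resources -/

/-- Vectors over the Hilbert space with orthonormal basis indexed by `Q → {0,1}`. -/
def Vec {Qubit : Type} (Q : Finset Qubit) : Type := ({ q // q ∈ Q } → Bool) → ℂ

/-- A quantum state: a finite set of qubits together with a vector over them. -/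
def QState (Qubit : Type) : Type := Σ Q : Finset Qubit, Vec Q

/-- A store: a partial function from variables to values. -/
def Store (Var Val : Type) : Type := Var → Option Val

/-- A resource: a quantum state together with a store. -/
def Res (Qubit Var Val : Type) : Type := QState Qubit × Store Var Val

variable {Qubit Var Val : Type}

/-- Tensor product of vectors over disjoint qubit sets. -/
def tensorVec {Q Q' : Finset Qubit} (v : Vec Q) (w : Vec Q') : Vec (Q ∪ Q') := fun f =>
  v (fun q => f ⟨q.1, Finset.mem_union_left _ q.2⟩) *
  w (fun q => f ⟨q.1, Finset.mem_union_right _ q.2⟩)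

/-- Transport of a vector along an equality of qubit sets. -/
def castVec {Q Q' : Finset Qubit} (h : Q = Q') (v : Vec Q) : Vec Q' := h ▸ v

/-- The empty quantum state with scalar 1. -/
def unitQ : QState Qubit := ⟨(∅ : Finset Qubit), fun _ => 1⟩

/-- The unit resource: empty qubit set with scalar 1 and the empty store. -/
def unitRes : Res Qubit Var Val := (unitQ, fun _ => none)

/-- Partial product of resources: defined iff the qubit sets are disjoint and
the store domains are disjoint; takes the union of qubit sets, tensor product of
vectors, and union of stores. -/
def rmul (a b : Res Qubit Var Val) : Option (Res Qubit Var Val) :=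
  if h : Disjoint a.1.1 b.1.1 ∧ ∀ x, a.2 x = none ∨ b.2 x = none then
    some (⟨a.1.1 ∪ b.1.1, tensorVec a.1.2 b.1.2⟩, fun x => a.2 x <|> b.2 x)
  else none

/-- Partial sum of resources: defined iff the two resources have the same
qubit set and the same store; adds the vectors. -/
def radd (a b : Res Qubit Var Val) : Option (Res Qubit Var Val) :=
  if h : a.1.1 = b.1.1 ∧ a.2 = b.2 then
    some (⟨b.1.1, fun f => castVec h.1 a.1.2 f + b.1.2 f⟩, b.2)
  else none

/-- Incompatibility of resources: some variable lies in both store domains and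
the stores disagree on it. -/
def incompat (a b : Res Qubit Var Val) : Prop :=
  ∃ x u u', a.2 x = some u ∧ b.2 x = some u' ∧ u ≠ u'

/-! ## The programming language (values are natural numbers) -/

/-- Pure expressions: constants, variables, operations applied to subexpressions. -/
inductive Expr (Var : Type) : Type
  | const : ℕ → Expr Var
  | evar : Var → Expr Var
  | op : (n : ℕ) → ((Fin n → ℕ) → ℕ) → (Fin n → Expr Var) → Expr Var

/-- Evaluation of a pure expression in a store; undefined on variables outside
the store's domain. -/
def Expr.eval {Var : Type} (S : Store Var ℕ) : Expr Var → Option ℕ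
  | .const n => some n
  | .evar x => S x
  | .op n f es =>
      if h : ∀ i, (Expr.eval S (es i)).isSome then
        some (f (fun i => (Expr.eval S (es i)).get (h i)))
      else none

/-- A unitary operator on `n` qubits, as a matrix with orthonormal columns. -/
structure UnitaryOp (n : ℕ) : Type where
  mat : (Fin n → Bool) → (Fin n → Bool) → ℂ
  unitary : ∀ a b, (∑ c : Fin n → Bool, (starRingEnd ℂ) (mat c a) * mat c b) =
    if a = b then 1 else 0

/-- A measurement: a finite family of linear operators `M⁽ⁱ⁾` on `n` qubits
with `Σᵢ (M⁽ⁱ⁾)† M⁽ⁱ⁾ = I`. -/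
structure MeasOp (k n : ℕ) : Type where
  ops : Fin k → (Fin n → Bool) → (Fin n → Bool) → ℂ
  complete : ∀ a b,
    (∑ i : Fin k, ∑ c : Fin n → Bool, (starRingEnd ℂ) (ops i c a) * ops i c b) =
      if a = b then 1 else 0


/-- Apply an operator (given by its matrix) to the designated qubits of a
quantum state; defined iff the designated qubits are distinct and all present. -/
def applyOp {n : ℕ} (mat : (Fin n → Bool) → (Fin n → Bool) → ℂ) (qs : Fin n → Qubit)
    (ψ : QState Qubit) : Option (QState Qubit) :=
  if h : Function.Injective qs ∧ ∀ i, qs i ∈ ψ.1 then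
    some ⟨ψ.1, fun g => ∑ b : Fin n → Bool,
      mat (fun i => g ⟨qs i, h.2 i⟩) b *
      ψ.2 (fun q => if h' : ∃ i, qs i = q.1 then b h'.choose else g q)⟩
  else none

/-- Commands of the language. -/
inductive Cmd (Qubit Var : Type) : Type
  | skip
  | seq (c c' : Cmd Qubit Var)
  | ite (e : Expr Var) (c1 c0 : Cmd Qubit Var)
  | whileC (e : Expr Var) (c : Cmd Qubit Var)
  | assign (x : Var) (e : Expr Var)
  | unitary (n : ℕ) (U : UnitaryOp n) (qs : Fin n → Qubit)
  | measure (x : Var) (k n : ℕ) (M : MeasOp k n) (qs : Fin n → Qubit)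

/-! ## Behaviour trees (represented as partial labelling functions on paths) -/

/-- Node labels of behaviour trees. -/
inductive BLabel (Qubit Var : Type) : Type
  | branch (k : ℕ)
  | leaf (a : Res Qubit Var ℕ)
  | nil

/-- Behaviour trees, represented by their partial labelling function on paths. -/
def BTree (Qubit Var : Type) : Type := List ℕ → Option (BLabel Qubit Var)

/-- The tree `Nil`. -/
def nilTree : BTree Qubit Var := fun p => if p = [] then some BLabel.nil else none

/-- The tree `Leaf a`. -/
def leafTree (a : Res Qubit Var ℕ) : BTree Qubit Var :=
  fun p => if p = [] then some (BLabel.leaf a) else none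

/-- The tree `Branch` with `k` children. -/
def branchTree (k : ℕ) (child : Fin k → BTree Qubit Var) : BTree Qubit Var := fun p =>
  match p with
  | [] => some (BLabel.branch k)
  | i :: p' => if h : i < k then child ⟨i, h⟩ p' else none

/-- Iterated child access `t.ī`. -/
def BTree.access (t : BTree Qubit Var) (is : List ℕ) : BTree Qubit Var :=
  fun p => t (is ++ p)

/-- Branching of partially-defined children: defined iff all children are. -/
def branchOpt (k : ℕ) (f : Fin k → Option (BTree Qubit Var)) : Option (BTree Qubit Var) :=
  if h : ∀ i, (f i).isSome then some (branchTree k (fun i => (f i).get (h i))) else none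

/-- Store update. -/
def updStore (S : Store Var ℕ) (x : Var) (v : ℕ) : Store Var ℕ :=
  fun y => if y = x then some v else S y

/-! ## Denotational semantics -/

/-- The `n`-th approximation of the denotational semantics, rendering
computations unfinished after `n` unfolding steps as `Nil`. -/
def semN : ℕ → List (Cmd Qubit Var) → QState Qubit → Store Var ℕ → Option (BTree Qubit Var)
  | 0, _, _, _ => some nilTree
  | _ + 1, [], ψ, S => some (leafTree (ψ, S))
  | n + 1, Cmd.skip :: cs, ψ, S => semN n cs ψ S
  | n + 1, Cmd.seq c c' :: cs, ψ, S => semN n (c :: c' :: cs) ψ S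
  | n + 1, Cmd.ite e c1 c0 :: cs, ψ, S =>
      match Expr.eval S e with
      | some 1 => semN n (c1 :: cs) ψ S
      | some 0 => semN n (c0 :: cs) ψ S
      | _ => none
  | n + 1, Cmd.whileC e c :: cs, ψ, S =>
      semN n (Cmd.ite e (Cmd.seq c (Cmd.whileC e c)) Cmd.skip :: cs) ψ S
  | n + 1, Cmd.assign x e :: cs, ψ, S =>
      match S x, Expr.eval S e with
      | some _, some v => semN n cs ψ (updStore S x v)
      | _, _ => none
  | n + 1, Cmd.unitary nq U qs :: cs, ψ, S =>
      match applyOp U.mat qs ψ with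
      | some ψ' => semN n cs ψ' S
      | none => none
  | n + 1, Cmd.measure x k nq M qs :: cs, ψ, S =>
      match S x with
      | some _ =>
          branchOpt k (fun i =>
            (applyOp (M.ops i) qs ψ).bind (fun ψ' => semN n cs ψ' (updStore S x i.1)))
      | none => none

/-- The denotational semantics: defined iff all approximations are, and then
the limit (least upper bound) of the ω-chain of approximations. -/
def sem (cs : List (Cmd Qubit Var)) (ψ : QState Qubit) (S : Store Var ℕ) :
    Option (BTree Qubit Var) :=
  if h : ∀ n, (semN n cs ψ S).isSome then
    some (fun p =>
      if h1 : ∃ n l, ((semN n cs ψ S).get (h n)) p = some l ∧ l ≠ BLabel.nil then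
        some h1.choose_spec.choose
      else if ∃ n, ((semN n cs ψ S).get (h n)) p = some BLabel.nil then some BLabel.nil
      else none)
  else none

/-- Framing relation on optional labels. -/
inductive FR (x : Res Qubit Var ℕ) :
    Option (BLabel Qubit Var) → Option (BLabel Qubit Var) → Prop
  | none : FR x none none
  | nil : FR x (some BLabel.nil) (some BLabel.nil)
  | branch (k : ℕ) : FR x (some (BLabel.branch k)) (some (BLabel.branch k))
  | leaf (b bx : Res Qubit Var ℕ) (h : rmul b x = some bx) :
      FR x (some (BLabel.leaf b)) (some (BLabel.leaf bx))

theorem eval_mono {S S' : Store Var ℕ} (h : ∀ y v, S y = some v → S' y = some v)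
    (e : Expr Var) : ∀ v, Expr.eval S e = some v → Expr.eval S' e = some v := by
  induction e with
  | const n => intro v hv; simpa [Expr.eval] using hv
  | evar y => intro v hv; simp only [Expr.eval] at hv ⊢; exact h _ _ hv
  | op n f es ih =>
    intro v hv
    simp only [Expr.eval] at hv ⊢
    split_ifs at hv with h1
    have h3 : ∀ i, Expr.eval S' (es i) = Expr.eval S (es i) := by
      intro i
      obtain ⟨w, hw⟩ := Option.isSome_iff_exists.1 (h1 i)
      rw [hw]; exact ih i w hw
    have h2 : ∀ i, (Expr.eval S' (es i)).isSome := fun i => by rw [h3 i]; exact h1 i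
    rw [dif_pos h2]
    rw [← hv]
    simp only [h3]

/-- Explicit form of the product of quantum states. -/
def qmul (ψ φ : QState Qubit) : QState Qubit := ⟨ψ.1 ∪ φ.1, tensorVec ψ.2 φ.2⟩

/-- Explicit form of the union of stores. -/
def smul' (S T : Store Var Val) : Store Var Val := fun x => S x <|> T x

theorem rmul_eq_some {a x ax : Res Qubit Var Val} :
    rmul a x = some ax ↔ (Disjoint a.1.1 x.1.1 ∧ ∀ y, a.2 y = none ∨ x.2 y = none) ∧
      ax = (qmul a.1 x.1, smul' a.2 x.2) := by
  unfold rmul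
  split_ifs with h
  · exact ⟨fun h' => ⟨h, (Option.some.inj h').symm⟩, fun h' => congrArg some h'.2.symm⟩
  · exact ⟨fun h' => absurd h' (by simp), fun h' => absurd h'.1 h⟩

theorem applyOp_frame {n : ℕ} (mat : (Fin n → Bool) → (Fin n → Bool) → ℂ) (qs : Fin n → Qubit)
    (ψ φ ψ' : QState Qubit) (hd : Disjoint ψ.1 φ.1) (h : applyOp mat qs ψ = some ψ') :
    ψ'.1 = ψ.1 ∧ applyOp mat qs (qmul ψ φ) = some (qmul ψ' φ) := by
  unfold applyOp at h
  split_ifs at h with h1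
  replace h := Option.some.inj h
  subst h
  refine ⟨rfl, ?_⟩
  have h2 : Function.Injective qs ∧ ∀ i, qs i ∈ (qmul ψ φ).1 :=
    ⟨h1.1, fun i => Finset.mem_union_left _ (h1.2 i)⟩
  unfold applyOp
  rw [dif_pos h2]
  refine congrArg some ?_
  unfold qmul
  refine congrArg (Sigma.mk (ψ.1 ∪ φ.1)) ?_
  funext g
  simp only [tensorVec]
  rw [Finset.sum_mul]
  refine Finset.sum_congr rfl fun b _ => ?_
  rw [mul_assoc]
  congr 2
  refine congrArg φ.2 ?_
  funext q
  rw [dif_neg]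
  rintro ⟨i, hi⟩
  exact Finset.disjoint_left.1 hd (h1.2 i) (hi ▸ q.2)

theorem smul'_upd (S T : Store Var ℕ) (y : Var) (v : ℕ) :
    smul' (updStore S y v) T = updStore (smul' S T) y v := by
  funext z
  by_cases h : z = y <;> simp [smul', updStore, h]

theorem smul'_some {S T : Store Var ℕ} (y : Var) (v : ℕ) (h : S y = some v) :
    smul' S T y = some v := by simp [smul', h]

theorem disj_upd {S T : Store Var ℕ} (h : ∀ y, S y = none ∨ T y = none) {y : Var} {w : ℕ}
    (hy : S y = some w) (v : ℕ) : ∀ z, updStore S y v z = none ∨ T z = none := by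
  intro z
  by_cases hz : z = y
  · subst hz; right; rcases h z with h | h
    · simp [hy] at h
    · exact h
  · simpa [updStore, hz] using h z

theorem branchOpt_some {k : ℕ} {f : Fin k → Option (BTree Qubit Var)} {t : BTree Qubit Var} :
    branchOpt k f = some t ↔ ∃ c : Fin k → BTree Qubit Var, (∀ i, f i = some (c i)) ∧
      t = branchTree k c := by
  unfold branchOpt
  constructor
  · intro h
    split_ifs at h with h1
    rw [Option.some.injEq] at h
    exact ⟨fun i => (f i).get (h1 i), fun i => by simp, h.symm⟩
  · rintro ⟨c, hc, rfl⟩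
    have h1 : ∀ i, (f i).isSome := fun i => by simp [hc]
    rw [dif_pos h1]
    refine congrArg some (congrArg _ ?_)
    funext i; simp [hc]

theorem semN_frame (x : Res Qubit Var ℕ) (n : ℕ) : ∀ (cs : List (Cmd Qubit Var))
    (ψ : QState Qubit) (S : Store Var ℕ) (t : BTree Qubit Var),
    Disjoint ψ.1 x.1.1 → (∀ y, S y = none ∨ x.2 y = none) → semN n cs ψ S = some t →
    ∃ t', semN n cs (qmul ψ x.1) (smul' S x.2) = some t' ∧ ∀ p, FR x (t p) (t' p) := by
  induction n with
  | zero =>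
    intro cs ψ S t hd hs h
    simp only [semN, Option.some.injEq] at h ⊢
    subst h
    refine ⟨_, rfl, fun p => ?_⟩
    unfold nilTree; split_ifs <;> constructor
  | succ n ih =>
    intro cs ψ S t hd hs h
    rcases cs with _ | ⟨c, cs⟩
    · simp only [semN, Option.some.injEq] at h ⊢
      subst h
      refine ⟨_, rfl, fun p => ?_⟩
      unfold leafTree
      split_ifs <;> constructor
      exact rmul_eq_some.2 ⟨⟨hd, hs⟩, rfl⟩
    · cases c with
      | skip => simp only [semN] at h ⊢; exact ih _ _ _ _ hd hs h
      | seq c c' => simp only [semN] at h ⊢; exact ih _ _ _ _ hd hs h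
      | whileC e c => simp only [semN] at h ⊢; exact ih _ _ _ _ hd hs h
      | ite e c1 c0 =>
        simp only [semN] at h ⊢
        split at h
        · rename_i he
          rw [eval_mono (fun y v => smul'_some (T := x.2) y v) _ _ he]
          exact ih _ _ _ _ hd hs h
        · rename_i he
          rw [eval_mono (fun y v => smul'_some (T := x.2) y v) _ _ he]
          exact ih _ _ _ _ hd hs h
        · simp at h
      | assign y e =>
        simp only [semN] at h ⊢
        split at h
        · rename_i w v hw he
          rw [eval_mono (fun y v => smul'_some (T := x.2) y v) _ _ he, smul'_some _ _ hw]
          simp only [← smul'_upd]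
          exact ih _ _ _ _ hd (disj_upd hs hw v) h
        · simp at h
      | unitary nq U qs =>
        simp only [semN] at h ⊢
        split at h
        · rename_i ψ' he
          obtain ⟨h1, h2⟩ := applyOp_frame _ _ _ x.1 _ hd he
          rw [h2]
          exact ih _ _ _ _ (h1 ▸ hd) hs h
        · simp at h
      | measure y k nq M qs =>
        simp only [semN] at h ⊢
        split at h
        · rename_i w hw
          rw [smul'_some _ _ hw]
          obtain ⟨c, hc, rfl⟩ := branchOpt_some.1 h
          have key : ∀ i, ∃ t', (applyOp (M.ops i) qs (qmul ψ x.1)).bind (fun ψ' =>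
              semN n cs ψ' (updStore (smul' S x.2) y i.1)) = some t' ∧
              ∀ p, FR x (c i p) (t' p) := by
            intro i
            obtain ⟨ψ', h1, h2⟩ := Option.bind_eq_some_iff.1 (hc i)
            obtain ⟨h3, h4⟩ := applyOp_frame _ _ _ x.1 _ hd h1
            rw [h4, ← smul'_upd]
            exact ih _ _ _ _ (h3 ▸ hd) (disj_upd hs hw _) h2
          choose c' hc' hF using key
          refine ⟨_, branchOpt_some.2 ⟨c', hc', rfl⟩, fun p => ?_⟩
          rcases p with _ | ⟨i, p⟩
          · exact FR.branch k
          · simp only [branchTree]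
            split_ifs
            · exact hF _ _
            · exact FR.none
        · simp at h

theorem semN_mono (n : ℕ) : ∀ (cs : List (Cmd Qubit Var))
    (ψ : QState Qubit) (S : Store Var ℕ) (t t' : BTree Qubit Var),
    semN n cs ψ S = some t → semN (n + 1) cs ψ S = some t' →
    ∀ p l, t p = some l → l ≠ BLabel.nil → t' p = some l := by
  induction n with
  | zero =>
    intro cs ψ S t t' h h' p l hl hn
    simp only [semN, Option.some.injEq] at h
    subst h
    unfold nilTree at hl
    split_ifs at hl
    simp only [Option.some.injEq] at hl
    exact absurd hl.symm hn
  | succ n ih =>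
    intro cs ψ S t t' h h'
    rcases cs with _ | ⟨c, cs⟩
    · simp only [semN, Option.some.injEq] at h h'
      subst h h'
      intro p l hl _; exact hl
    · cases c with
      | skip => rw [semN] at h h'; exact ih _ _ _ _ _ h h'
      | seq c c' => rw [semN] at h h'; exact ih _ _ _ _ _ h h'
      | whileC e c => rw [semN] at h h'; exact ih _ _ _ _ _ h h'
      | ite e c1 c0 =>
        rw [semN] at h h'
        split at h
        · rename_i he
          rw [he] at h'
          exact ih _ _ _ _ _ h h'
        · rename_i he
          rw [he] at h'
          exact ih _ _ _ _ _ h h'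
        · simp at h
      | assign y e =>
        rw [semN] at h h'
        split at h
        · rename_i w v hw he
          rw [hw, he] at h'
          exact ih _ _ _ _ _ h h'
        · simp at h
      | unitary nq U qs =>
        rw [semN] at h h'
        split at h
        · rename_i ψ' he
          rw [he] at h'
          exact ih _ _ _ _ _ h h'
        · simp at h
      | measure y k nq M qs =>
        rw [semN] at h h'
        split at h
        · rename_i w hw
          rw [hw] at h'
          obtain ⟨c, hc, rfl⟩ := branchOpt_some.1 h
          obtain ⟨c', hc', rfl⟩ := branchOpt_some.1 h'
          intro p l hl hn
          rcases p with _ | ⟨i, p⟩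
          · exact hl
          · simp only [branchTree] at hl ⊢
            split_ifs at hl ⊢ with hi
            obtain ⟨ψ', h1, h2⟩ := Option.bind_eq_some_iff.1 (hc ⟨i, hi⟩)
            obtain ⟨ψ'', h3, h4⟩ := Option.bind_eq_some_iff.1 (hc' ⟨i, hi⟩)
            rw [h1, Option.some.injEq] at h3
            subst h3
            exact ih _ _ _ _ _ h2 h4 p l hl hn
        · simp at h

theorem sem_spec {cs : List (Cmd Qubit Var)} {ψ : QState Qubit} {S : Store Var ℕ}
    {t : BTree Qubit Var} (ht : sem cs ψ S = some t) :
    ∃ s : ℕ → BTree Qubit Var, (∀ n, semN n cs ψ S = some (s n)) ∧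
      ∀ p, (∃ n, s n p = t p) ∧
        (∀ n l, s n p = some l → l ≠ BLabel.nil → t p = some l) ∧
        (∀ n, s n p = some BLabel.nil → (t p).isSome) := by
  unfold sem at ht
  split_ifs at ht with h
  replace ht := Option.some.inj ht
  have hs : ∀ n, semN n cs ψ S = some ((semN n cs ψ S).get (h n)) := fun n => by simp
  refine ⟨fun n => (semN n cs ψ S).get (h n), hs, fun p => ?_⟩
  have mono : ∀ m n, m ≤ n → ∀ l, ((semN m cs ψ S).get (h m)) p = some l → l ≠ BLabel.nil →
      ((semN n cs ψ S).get (h n)) p = some l := by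
    intro m n hmn l hl hn
    induction n, hmn using Nat.le_induction with
    | base => exact hl
    | succ n _ ih => exact semN_mono n cs ψ S _ _ (hs n) (hs (n + 1)) p l ih hn
  subst ht
  by_cases h1 : ∃ n l, ((semN n cs ψ S).get (h n)) p = some l ∧ l ≠ BLabel.nil
  · simp only [dif_pos h1]
    have h2 := h1.choose_spec.choose_spec
    refine ⟨⟨_, h2.1⟩, ?_, fun _ _ => rfl⟩
    intro n l hl hn
    rw [← mono _ _ (le_max_left n h1.choose) l hl hn]
    exact (mono _ _ (le_max_right n h1.choose) _ h2.1 h2.2).symm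
  · simp only [dif_neg h1]
    by_cases h2 : ∃ n, ((semN n cs ψ S).get (h n)) p = some BLabel.nil
    · simp only [if_pos h2]
      exact ⟨h2, fun n l hl hn => absurd ⟨n, l, hl, hn⟩ h1, fun _ _ => rfl⟩
    · simp only [if_neg h2]
      refine ⟨⟨0, ?_⟩, fun n l hl hn => absurd ⟨n, l, hl, hn⟩ h1, fun n hn => absurd ⟨n, hn⟩ h2⟩
      cases hc : ((semN 0 cs ψ S).get (h 0)) p with
      | none => rfl
      | some l =>
        by_cases hl : l = BLabel.nil
        · subst hl; exact absurd ⟨0, hc⟩ h2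
        · exact absurd ⟨0, l, hc, hl⟩ h1

theorem sem_FR (cs : List (Cmd Qubit Var))
    (a x ax : Res Qubit Var ℕ) (t t' : BTree Qubit Var)
    (ht : sem cs a.1 a.2 = some t) (hax : rmul a x = some ax)
    (ht' : sem cs ax.1 ax.2 = some t') (p : List ℕ) : FR x (t p) (t' p) := by
  obtain ⟨⟨hd, hs⟩, rfl⟩ := rmul_eq_some.1 hax
  obtain ⟨s, h1, h2⟩ := sem_spec ht
  obtain ⟨s', h1', h2'⟩ := sem_spec ht'
  have hF : ∀ n, FR x (s n p) (s' n p) := by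
    intro n
    obtain ⟨u, hu, hF⟩ := semN_frame x n cs a.1 a.2 (s n) hd hs (h1 n)
    have h3 := (h1' n).symm.trans hu
    rw [Option.some.injEq] at h3
    rw [h3]; exact hF p
  obtain ⟨⟨n, hn⟩, hA, hB⟩ := h2 p
  obtain ⟨⟨m, hm⟩, hA', hB'⟩ := h2' p
  have hFn := hF n
  have hFm := hF m
  rw [hn] at hFn
  rw [hm] at hFm
  generalize hv : s' n p = v at hFn
  generalize hw : s m p = w at hFm
  generalize hu : t p = u at *
  generalize hu' : t' p = u' at *
  cases hFn with
  | none =>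
    cases hFm with
    | none => exact FR.none
    | nil => have := hB _ hw; simp at this
    | branch k => have := hA _ _ hw (by simp); simp at this
    | leaf b bx h => have := hA _ _ hw (by simp); simp at this
  | nil =>
    cases hFm with
    | none => have := hB' _ hv; simp at this
    | nil => exact FR.nil
    | branch k => have := hA _ _ hw (by simp); simp at this
    | leaf b bx h => have := hA _ _ hw (by simp); simp at this
  | branch k =>
    rw [hA' _ _ hv (by simp)]; exact FR.branch k
  | leaf b bx h =>
    rw [hA' _ _ hv (by simp)]; exact FR.leaf b bx h

/-- Frame on denotations: the denotation on `a·x` is obtained from the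
denotation on `a` by replacing every leaf `Leaf b` by `Leaf (b·x)`; in
particular the two trees have the same shape and all the products `b·x` at
leaves are defined. -/
theorem denosem_frame {Qubit Var : Type} (cs : List (Cmd Qubit Var))
    (a x ax : Res Qubit Var ℕ) (t t' : BTree Qubit Var)
    (ht : sem cs a.1 a.2 = some t) (hax : rmul a x = some ax)
    (ht' : sem cs ax.1 ax.2 = some t') :
    ∀ p : List ℕ,
      ((t p).isSome ↔ (t' p).isSome)
      ∧ (∀ k, t p = some (BLabel.branch k) → t' p = some (BLabel.branch k))
      ∧ (t p = some BLabel.nil → t' p = some BLabel.nil)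
      ∧ (∀ b, t p = some (BLabel.leaf b) →
          ∃ bx, rmul b x = some bx ∧ t' p = some (BLabel.leaf bx)) := by
  intro p
  have h := sem_FR cs a x ax t t' ht hax ht' p
  generalize t p = u at *
  generalize t' p = u' at *
  cases h with
  | none => simp
  | nil => simp
  | branch k => simp
  | leaf b bx h =>
    refine ⟨by simp, by simp, by simp, ?_⟩
    intro b' hb
    simp only [Option.some.injEq, BLabel.leaf.injEq] at hb
    subst hb
    exact ⟨bx, h, rfl⟩
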